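/- arXiv:1503.06603 — 3 statements merged into one kernel-verified Lean document; each statement's English description precedes it below -/
import Mathlib

section
/- Let A : ℝ → Mat_{n×n}(ℝ), let Y : ℝ → Mat_{n×(n−1)}(ℝ) be differentiable, and let Z : ℝ → Mat_{n×(n−1)}(ℝ) satisfy Z(t)ᵀ Y(t) = I_{n−1} for all t. Let p : ℝ → ℝⁿ be differentiable with p'(t) = A(t) p(t), let α ∈ ℝ, and let R : ℝ → ℝ^{n−1} be differentiable. If y(t) := α p(t) + Y(t) R(t) satisfies y'(t) = A(t) y(t) for all t, then R satisfies the amplitude variational equation R'(t) = Z(t)ᵀ ( A(t) Y(t) − Y'(t) ) R(t) for all t. -/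
open Matrix

/-- Product rule for a matrix with differentiable entries acting on a differentiable vector. -/
theorem hasDerivAt_mulVec {ι κ : Type*} [Fintype ι] [Fintype κ]
    {M : ℝ → Matrix ι κ ℝ} {M' : Matrix ι κ ℝ} {v : ℝ → κ → ℝ} {v' : κ → ℝ} {t : ℝ}
    (hM : ∀ i k, HasDerivAt (fun s => M s i k) (M' i k) t) (hv : HasDerivAt v v' t) :
    HasDerivAt (fun s => M s *ᵥ v s) (M' *ᵥ v t + M t *ᵥ v') t := by
  rw [hasDerivAt_pi] at hv ⊢
  intro i
  simp only [mulVec, dotProduct, Pi.add_apply, ← Finset.sum_add_distrib]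
  exact HasDerivAt.fun_sum fun k _ => (hM i k).fun_mul (hv k)

/-- Equations (26)–(28) in the proof of Theorem 2: if `y t = α • p t + Y t *ᵥ R t`
solves the variational equation `y' = A t *ᵥ y`, where `p' = A p` (the tangent
solution), `Y` collects the transversal basis vectors and `Zᵀ Y = 1` is the
bi-orthogonality condition, then the amplitude `R` satisfies the amplitude
variational equation `R' = Zᵀ (A Y − Y') *ᵥ R`. -/
theorem stmt_3 (n m : ℕ)
    (A : ℝ → Matrix (Fin n) (Fin n) ℝ)
    (Y Y' : ℝ → Matrix (Fin n) (Fin m) ℝ)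
    (hY : ∀ t i k, HasDerivAt (fun s => Y s i k) (Y' t i k) t)
    (Z : ℝ → Matrix (Fin n) (Fin m) ℝ)
    (hZ : ∀ t, (Z t)ᵀ * Y t = 1)
    (p : ℝ → (Fin n → ℝ))
    (hp : ∀ t, HasDerivAt p (A t *ᵥ p t) t)
    (α : ℝ)
    (R R' : ℝ → (Fin m → ℝ))
    (hR : ∀ t, HasDerivAt R (R' t) t)
    (hy : ∀ t, HasDerivAt (fun s => α • p s + Y s *ᵥ R s)
      (A t *ᵥ (α • p t + Y t *ᵥ R t)) t) :
    ∀ t, R' t = ((Z t)ᵀ * (A t * Y t - Y' t)) *ᵥ R t := by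
  intro t
  have h := (hy t).unique (((hp t).fun_const_smul α).fun_add (hasDerivAt_mulVec (hY t) (hR t)))
  rw [mulVec_add, mulVec_smul, add_right_inj] at h
  calc R' t = (Z t)ᵀ *ᵥ (Y t *ᵥ R' t) := by rw [mulVec_mulVec, hZ, one_mulVec]
    _ = (Z t)ᵀ *ᵥ (A t *ᵥ (Y t *ᵥ R t) - Y' t *ᵥ R t) := by rw [h, add_sub_cancel_left]
    _ = ((Z t)ᵀ * (A t * Y t - Y' t)) *ᵥ R t := by
      rw [mulVec_mulVec, ← sub_mulVec, mulVec_mulVec]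
end

section
/- Let T > 0, let A : ℝ → Mat_{n×n}(ℝ) be continuous with A(t+T) = A(t) for all t. Let p : ℝ → ℝⁿ be differentiable, T-periodic, with p(t) ≠ 0 and p'(t) = A(t)p(t) for all t. Let Y : ℝ → Mat_{n×(n−1)}(ℝ) be continuously differentiable and T-periodic such that the n×n matrix U(t) := [p(t) | Y(t)] is invertible for every t, and let Z(t)ᵀ denote the last n−1 rows of U(t)⁻¹. Let Φ : ℝ → Mat_{n×n}(ℝ) be differentiable with Φ(0) = I_n and Φ'(t) = A(t)Φ(t), and let Q : ℝ → Mat_{(n−1)×(n−1)}(ℝ) be differentiable with Q(0) = I_{n−1} and Q'(t) = Z(t)ᵀ( A(t)Y(t) − Y'(t) ) Q(t). Then the characteristic polynomial of the monodromy matrix Φ(T) factors as charpoly(Φ(T)) = (X − 1) · charpoly(Q(T)); in particular the characteristic multipliers of y' = A(t)y are 1 together with the characteristic multipliers of the amplitude variational equation R' = Zᵀ(AY − Y')R. -/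
open Matrix

section EntrywiseCalculus

variable {l m n : Type*} [Fintype m]

/-- The product rule for matrix-valued functions, entry by entry. -/
lemma Matrix.hasDerivAt_mul_apply {M : ℝ → Matrix l m ℝ} {N : ℝ → Matrix m n ℝ}
    {M' : Matrix l m ℝ} {N' : Matrix m n ℝ} {t : ℝ}
    (hM : ∀ i j, HasDerivAt (fun s => M s i j) (M' i j) t)
    (hN : ∀ i j, HasDerivAt (fun s => N s i j) (N' i j) t) (i : l) (j : n) :
    HasDerivAt (fun s => (M s * N s) i j) ((M' * N t + M t * N') i j) t := by
  simp only [Matrix.add_apply, Matrix.mul_apply, ← Finset.sum_add_distrib]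
  exact HasDerivAt.fun_sum fun k _ => (hM i k).mul (hN k j)

/-- The inverse of a continuous family of invertible matrices is continuous. -/
lemma Continuous.matrix_inv {X : Type*} [TopologicalSpace X] [DecidableEq m]
    {M : X → Matrix m m ℝ} (hM : Continuous M) (hinv : ∀ x, IsUnit (M x)) :
    Continuous fun x => (M x)⁻¹ := by
  simp only [Matrix.inv_def, Ring.inverse_eq_inv']
  exact (hM.matrix_det.inv₀ fun x => ((Matrix.isUnit_iff_isUnit_det _).1 (hinv x)).ne_zero).smul
    hM.matrix_adjugate

end EntrywiseCalculus

open scoped Matrix.Norms.Operator in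
/-- Solutions of a linear differential equation with continuous coefficients are determined by
their value at the initial time. -/
lemma linearODE_solution_unique {n : Type*} [Fintype n] {A : ℝ → Matrix n n ℝ}
    (hA : Continuous A) {f g : ℝ → n → ℝ}
    (hf : ∀ t, HasDerivAt f (A t *ᵥ f t) t) (hg : ∀ t, HasDerivAt g (A t *ᵥ g t) t)
    (h0 : f 0 = g 0) {T : ℝ} (hT : 0 ≤ T) : f T = g T := by
  obtain ⟨K, hK⟩ := (isCompact_Icc (a := (0 : ℝ)) (b := T)).exists_bound_of_continuousOn
    hA.continuousOn
  have hlip : ∀ t ∈ Set.Ico 0 T,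
      LipschitzOnWith K.toNNReal (fun x => A t *ᵥ x) (Set.univ : Set (n → ℝ)) := by
    intro t ht
    refine LipschitzOnWith.of_dist_le_mul fun x _ y _ => ?_
    rw [dist_eq_norm, dist_eq_norm, ← Matrix.mulVec_sub]
    refine (Matrix.linfty_opNorm_mulVec _ _).trans ?_
    gcongr
    exact (hK t ⟨ht.1, ht.2.le⟩).trans (Real.le_coe_toNNReal K)
  exact ODE_solution_unique_of_mem_Icc_right hlip
    (fun t _ => (hf t).continuousAt.continuousWithinAt) (fun t _ => (hf t).hasDerivWithinAt)
    (fun _ _ => Set.mem_univ _)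
    (fun t _ => (hg t).continuousAt.continuousWithinAt) (fun t _ => (hg t).hasDerivWithinAt)
    (fun _ _ => Set.mem_univ _) h0 ⟨hT, le_rfl⟩

/-- Matrix version of `linearODE_solution_unique`. -/
lemma linearODE_matrix_solution_unique {n k : Type*} [Fintype n] {A : ℝ → Matrix n n ℝ}
    (hA : Continuous A) {F G : ℝ → Matrix n k ℝ}
    (hF : ∀ t i j, HasDerivAt (fun s => F s i j) ((A t * F t) i j) t)
    (hG : ∀ t i j, HasDerivAt (fun s => G s i j) ((A t * G t) i j) t)
    (h0 : F 0 = G 0) {T : ℝ} (hT : 0 ≤ T) : F T = G T := by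
  ext i j
  exact congrFun (linearODE_solution_unique hA (f := fun t i => F t i j) (g := fun t i => G t i j)
    (fun t => hasDerivAt_pi.2 fun i => hF t i j) (fun t => hasDerivAt_pi.2 fun i => hG t i j)
    (by simp [h0]) hT) i

/-- The characteristic polynomial of a matrix whose first column vanishes below the diagonal. -/
lemma Matrix.charpoly_of_column_zero {R : Type*} [CommRing R] {m : ℕ}
    (N : Matrix (Fin (m + 1)) (Fin (m + 1)) R) (hN : ∀ k : Fin m, N k.succ 0 = 0) :
    N.charpoly = (Polynomial.X - Polynomial.C (N 0 0)) *
      (N.submatrix Fin.succ Fin.succ).charpoly := by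
  have hsub : N.charmatrix.submatrix Fin.succ Fin.succ =
      (N.submatrix Fin.succ Fin.succ).charmatrix := by
    ext1 i j
    simp [Matrix.charmatrix_apply, Matrix.diagonal_apply]
  rw [Matrix.charpoly, Matrix.det_succ_column_zero, Fin.sum_univ_succ]
  simp [hN, Matrix.charpoly, ← hsub]

/-- If `B` is a continuous coefficient matrix with vanishing first column and `Q` is the principal
fundamental matrix of its lower right block, then the system with coefficient matrix `B` has a
principal fundamental matrix with first column `e₀` and lower right block `Q`. -/
lemma exists_blockTriangular_fundamentalMatrix {m : ℕ}
    {B : ℝ → Matrix (Fin (m + 1)) (Fin (m + 1)) ℝ} (hB : Continuous B)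
    (hB0 : ∀ t i, B t i 0 = 0) {Q : ℝ → Matrix (Fin m) (Fin m) ℝ} (hQ0 : Q 0 = 1)
    (hQ : ∀ t k l, HasDerivAt (fun s => Q s k l)
      (((B t).submatrix Fin.succ Fin.succ * Q t) k l) t) :
    ∃ N : ℝ → Matrix (Fin (m + 1)) (Fin (m + 1)) ℝ, N 0 = 1 ∧
      (∀ t i j, HasDerivAt (fun s => N s i j) ((B t * N t) i j) t) ∧
      ∀ t, N t 0 0 = 1 ∧ (∀ k : Fin m, N t k.succ 0 = 0) ∧
        (N t).submatrix Fin.succ Fin.succ = Q t := by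
  have hQc : ∀ k l, Continuous fun s => Q s k l := fun k l =>
    continuous_iff_continuousAt.2 fun t => (hQ t k l).continuousAt
  have hrow : ∀ l, Continuous fun s => ∑ k : Fin m, B s 0 k.succ * Q s k l := fun l =>
    continuous_finsetSum _ fun k _ => (hB.matrix_elem 0 k.succ).mul (hQc k l)
  let r : ℝ → Fin m → ℝ := fun t l => ∫ s in (0 : ℝ)..t, ∑ k : Fin m, B s 0 k.succ * Q s k l
  refine ⟨fun t => Matrix.of (Fin.cons (Fin.cons 1 (r t)) fun k => Fin.cons 0 (Q t k)),
    ?_, ?_, fun t => ⟨rfl, fun k => rfl, rfl⟩⟩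
  · ext i j
    cases i using Fin.cases <;> cases j using Fin.cases <;>
      simp [r, hQ0, Matrix.one_apply, Fin.succ_ne_zero, (Fin.succ_ne_zero _).symm]
  · intro t i j
    cases j using Fin.cases with
    | zero =>
      cases i using Fin.cases <;>
        simpa [Matrix.mul_apply, Fin.sum_univ_succ, hB0] using hasDerivAt_const t _
    | succ l =>
      cases i using Fin.cases with
      | zero =>
        simpa [Matrix.mul_apply, Fin.sum_univ_succ, hB0] using
          intervalIntegral.integral_hasDerivAt_right ((hrow l).intervalIntegrable 0 t)
            ((hrow l).stronglyMeasurableAtFilter _ _) (hrow l).continuousAt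
      | succ k => simpa [Matrix.mul_apply, Fin.sum_univ_succ, hB0] using hQ t k l

/-- Theorem 2 of the paper: for the `T`-periodic variational equation
`y' = A t *ᵥ y` along a limit cycle, with `p` the nonvanishing `T`-periodic
tangent solution, `Y` the (periodic, `C¹`) matrix of transversal basis vectors
such that `U t = [p t | Y t]` is invertible, and `Zᵀ` the last `n − 1` rows of
`U⁻¹`, the characteristic polynomial of the monodromy matrix `Φ T` factors as
`(X − 1) · charpoly (Q T)`, where `Q` is the principal fundamental matrix of the
amplitude variational equation `R' = Zᵀ (A Y − Y') R`.  Hence the characteristic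
multipliers are `1, μ₂, …, μₙ` with `μ₂, …, μₙ` those of the amplitude equation.
Here `n = m + 1`. -/
theorem stmt_4 (m : ℕ) (T : ℝ) (hT : 0 < T)
    (A : ℝ → Matrix (Fin (m + 1)) (Fin (m + 1)) ℝ)
    (hAcont : ∀ i j, Continuous fun t => A t i j)
    (hAper : ∀ t, A (t + T) = A t)
    (p : ℝ → (Fin (m + 1) → ℝ))
    (hp : ∀ t, HasDerivAt p (A t *ᵥ p t) t)
    (hpper : ∀ t, p (t + T) = p t)
    (hpne : ∀ t, p t ≠ 0)
    (Y Y' : ℝ → Matrix (Fin (m + 1)) (Fin m) ℝ)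
    (hY : ∀ t i k, HasDerivAt (fun s => Y s i k) (Y' t i k) t)
    (hY'cont : ∀ i k, Continuous fun t => Y' t i k)
    (hYper : ∀ t, Y (t + T) = Y t)
    (U : ℝ → Matrix (Fin (m + 1)) (Fin (m + 1)) ℝ)
    (hU : ∀ t i j, U t i j = (Fin.cons (p t i) (fun k => Y t i k) : Fin (m + 1) → ℝ) j)
    (hUinv : ∀ t, IsUnit (U t))
    (Zt : ℝ → Matrix (Fin m) (Fin (m + 1)) ℝ)
    (hZt : ∀ t k i, Zt t k i = (U t)⁻¹ k.succ i)
    (Φ : ℝ → Matrix (Fin (m + 1)) (Fin (m + 1)) ℝ)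
    (hΦ0 : Φ 0 = 1)
    (hΦ : ∀ t i j, HasDerivAt (fun s => Φ s i j) ((A t * Φ t) i j) t)
    (Q : ℝ → Matrix (Fin m) (Fin m) ℝ)
    (hQ0 : Q 0 = 1)
    (hQ : ∀ t k l, HasDerivAt (fun s => Q s k l)
      ((Zt t * (A t * Y t - Y' t) * Q t) k l) t) :
    (Φ T).charpoly = (Polynomial.X - 1) * (Q T).charpoly := by
  have hA : Continuous A := continuous_matrix hAcont
  have hpi : ∀ t i, HasDerivAt (fun s => p s i) ((A t *ᵥ p t) i) t := fun t =>
    hasDerivAt_pi.1 (hp t)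
  let U' : ℝ → Matrix (Fin (m + 1)) (Fin (m + 1)) ℝ := fun t =>
    Matrix.of fun i => Fin.cons ((A t *ᵥ p t) i) (Y' t i)
  have hUderiv : ∀ t i j, HasDerivAt (fun s => U s i j) (U' t i j) t := by
    intro t i j
    simp only [hU]
    cases j using Fin.cases with
    | zero => exact hpi t i
    | succ k => exact hY t i k
  have hUcont : Continuous U := continuous_matrix fun i j =>
    continuous_iff_continuousAt.2 fun t => (hUderiv t i j).continuousAt
  have hU'cont : Continuous U' := by
    refine continuous_matrix fun i j => ?_
    cases j using Fin.cases with
    | zero =>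
      have hpc : Continuous p := continuous_iff_continuousAt.2 fun t => (hp t).continuousAt
      exact (continuous_apply i).comp (hA.matrix_mulVec hpc)
    | succ k => exact hY'cont i k
  have hdet : ∀ t, IsUnit (U t).det := fun t => (Matrix.isUnit_iff_isUnit_det _).1 (hUinv t)
  let B : ℝ → Matrix (Fin (m + 1)) (Fin (m + 1)) ℝ := fun t => (U t)⁻¹ * (A t * U t - U' t)
  have hB : Continuous B :=
    (hUcont.matrix_inv hUinv).matrix_mul ((hA.matrix_mul hUcont).sub hU'cont)
  have hB0 : ∀ t i, B t i 0 = 0 := by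
    intro t i
    simp only [B, Matrix.mul_apply (M := (U t)⁻¹)]
    refine Finset.sum_eq_zero fun j _ => ?_
    simp [U', Matrix.mul_apply, hU, Matrix.mulVec, dotProduct]
  have hBQ : ∀ t, (B t).submatrix Fin.succ Fin.succ = Zt t * (A t * Y t - Y' t) := by
    intro t
    ext k l
    simp [B, U', Matrix.mul_apply, hU, hZt]
  obtain ⟨N, hN0, hN, hNblock⟩ := exists_blockTriangular_fundamentalMatrix hB hB0 hQ0
    (fun t k l => by simpa only [hBQ] using hQ t k l)
  have hUN : ∀ t i j, HasDerivAt (fun s => (U s * N s) i j) ((A t * (U t * N t)) i j) t := by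
    intro t i j
    have h : U' t * N t + U t * (B t * N t) = A t * (U t * N t) := by
      rw [← Matrix.mul_assoc (U t), Matrix.mul_nonsing_inv_cancel_left _ _ (hdet t),
        ← Matrix.add_mul, add_sub_cancel, Matrix.mul_assoc]
    rw [← h]
    exact Matrix.hasDerivAt_mul_apply (hUderiv t) (hN t) i j
  have hΦU : ∀ t i j, HasDerivAt (fun s => (Φ s * U 0) i j) ((A t * (Φ t * U 0)) i j) t := by
    intro t i j
    simpa [Matrix.mul_assoc] using Matrix.hasDerivAt_mul_apply (hΦ t)
      (N := fun _ => U 0) (N' := 0) (fun i j => hasDerivAt_const t (U 0 i j)) i j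
  have hUT : U T = U 0 := by
    ext i j
    have hpT := hpper 0
    have hYT := hYper 0
    rw [zero_add] at hpT hYT
    rw [hU, hU, hpT, hYT]
  have hconj : Φ T * U 0 = U 0 * N T := by
    simpa only [hUT] using linearODE_matrix_solution_unique hA hΦU hUN (by simp [hΦ0, hN0]) hT.le
  have hΦT : Φ T = (hUinv 0).unit.val * N T * (hUinv 0).unit.val⁻¹ := by
    rw [← Matrix.coe_units_inv, Units.eq_mul_inv_iff_mul_eq]
    exact hconj
  obtain ⟨hN00, hNcol, hNsub⟩ := hNblock T
  rw [hΦT, Matrix.charpoly_units_conj, Matrix.charpoly_of_column_zero _ hNcol, hN00, hNsub, map_one]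
end

section
/- Let R₀, y : [0, ∞) → ℝ be continuous with R₀(t) → 0 and y(t) → 1/4 as t → ∞, and let x : [0, ∞) → ℝ be differentiable with x'(t) = ( −2 + 6 R₀(t) − 3 R₀(t)² ) x(t) + 3 ( 1 − R₀(t) ) y(t) for all t ≥ 0. Then x(t) → 3/8 as t → ∞. -/
open Set Filter

/-- Solutions of a scalar linear equation `z' = a z + g` whose coefficient is eventually bounded
above by a negative constant and whose forcing tends to zero converge to zero. -/
theorem tendsto_zero_of_hasDerivAt_linear {a g z : ℝ → ℝ} {c : ℝ} (hc : 0 < c)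
    (ha : ∀ᶠ t in atTop, a t ≤ -c) (hg : Tendsto g atTop (nhds 0))
    (hz : ∀ᶠ t in atTop, HasDerivAt z (a t * z t + g t) t) :
    Tendsto z atTop (nhds 0) := by
  rw [Metric.tendsto_atTop']
  intro ε hε
  have hgε : ∀ᶠ t in atTop, g t ^ 2 < c ^ 2 * (ε ^ 2 / 2) := by
    have hg2 : Tendsto (fun t => g t ^ 2) atTop (nhds 0) := by simpa using hg.pow 2
    exact hg2.eventually_lt_const (by positivity)
  obtain ⟨T, hT⟩ := eventually_atTop.1 (ha.and (hgε.and hz))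
  have hderiv : ∀ t ∈ Ici T, HasDerivAt (fun s => Real.exp (c * s) * (z s ^ 2 - ε ^ 2 / 2))
      (Real.exp (c * t) * (c * (z t ^ 2 - ε ^ 2 / 2) + 2 * z t * (a t * z t + g t))) t := by
    intro t ht
    have h₁ : HasDerivAt (fun s => Real.exp (c * s)) (Real.exp (c * t) * c) t := by
      simpa using ((hasDerivAt_id t).const_mul c).exp
    have h₂ := ((hT t ht).2.2.pow 2).sub_const (ε ^ 2 / 2)
    refine (h₁.mul h₂).congr_deriv ?_
    simp only [Pi.pow_apply]
    ring
  have hanti : AntitoneOn (fun s => Real.exp (c * s) * (z s ^ 2 - ε ^ 2 / 2)) (Ici T) := by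
    refine antitoneOn_of_deriv_nonpos (convex_Ici T)
      (fun t ht => (hderiv t ht).continuousAt.continuousWithinAt)
      (fun t ht => (hderiv t (interior_subset ht)).differentiableAt.differentiableWithinAt)
      fun t ht => ?_
    have ht' := interior_subset ht
    rw [(hderiv t ht').deriv]
    refine mul_nonpos_of_nonneg_of_nonpos (Real.exp_pos _).le ?_
    obtain ⟨hat, hgt, -⟩ := hT t ht'
    have h₁ : a t * z t ^ 2 ≤ -c * z t ^ 2 := mul_le_mul_of_nonneg_right hat (sq_nonneg _)
    refine nonpos_of_mul_nonpos_right (a := c) ?_ hc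
    have h₂ := mul_le_mul_of_nonneg_left h₁ hc.le
    nlinarith [sq_nonneg (c * z t - g t)]
  have hexp : Tendsto (fun t => Real.exp (-(c * t)) *
      (Real.exp (c * T) * (z T ^ 2 - ε ^ 2 / 2))) atTop (nhds 0) := by
    simpa using (Real.tendsto_exp_neg_atTop_nhds_zero.comp
      (tendsto_id.const_mul_atTop hc)).mul_const (Real.exp (c * T) * (z T ^ 2 - ε ^ 2 / 2))
  obtain ⟨S, hS⟩ := eventually_atTop.1
    (hexp.eventually_lt_const (show 0 < ε ^ 2 / 2 by positivity))
  refine ⟨max S T, fun t ht => ?_⟩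
  have hSt := hS t ((le_max_left _ _).trans ht.le)
  have hTt : T ≤ t := (le_max_right _ _).trans ht.le
  have hle := mul_le_mul_of_nonneg_left (hanti self_mem_Ici hTt hTt) (Real.exp_pos (-(c * t))).le
  simp only [← mul_assoc, ← Real.exp_add, neg_add_cancel, Real.exp_zero, one_mul] at hle hSt
  rw [dist_zero_right, Real.norm_eq_abs]
  exact abs_lt_of_sq_lt_sq (by linarith) hε.le

/-- Section 5.1, equation (62): the expected second-order amplitude correction
`x = E[R₂]` of the noisy Stuart–Landau oscillator (orthogonal basis) satisfies
`x' = (−2 + 6 R₀ − 3 R₀²) x + 3 (1 − R₀) y` with `R₀ t → 0` and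
`y = E[R₁²] → 1/4`; every solution converges to the stationary value `3/8`. -/
theorem stmt_17 (R₀ y x : ℝ → ℝ)
    (hR₀cont : ContinuousOn R₀ (Ici 0))
    (hycont : ContinuousOn y (Ici 0))
    (hR₀ : Tendsto R₀ atTop (nhds 0))
    (hy : Tendsto y atTop (nhds (1 / 4)))
    (hx : ∀ t ∈ Ici (0 : ℝ),
      HasDerivWithinAt x
        ((-2 + 6 * R₀ t - 3 * R₀ t ^ 2) * x t + 3 * (1 - R₀ t) * y t) (Ici 0) t) :
    Tendsto x atTop (nhds (3 / 8)) := by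
  have ha : Tendsto (fun t => -2 + 6 * R₀ t - 3 * R₀ t ^ 2) atTop (nhds (-2)) := by
    simpa using ((hR₀.const_mul 6).const_add (-2)).sub ((hR₀.pow 2).const_mul 3)
  have hg : Tendsto (fun t => (-2 + 6 * R₀ t - 3 * R₀ t ^ 2) * (3 / 8) + 3 * (1 - R₀ t) * y t)
      atTop (nhds 0) := by
    convert (ha.mul_const (3 / 8)).add (((hR₀.const_sub 1).const_mul 3).mul hy) using 2
    norm_num
  have hz : ∀ᶠ t in atTop, HasDerivAt (fun s => x s - 3 / 8)
      ((-2 + 6 * R₀ t - 3 * R₀ t ^ 2) * (x t - 3 / 8) +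
        ((-2 + 6 * R₀ t - 3 * R₀ t ^ 2) * (3 / 8) + 3 * (1 - R₀ t) * y t)) t := by
    filter_upwards [eventually_gt_atTop 0] with t ht
    refine (((hx t (mem_Ici.2 ht.le)).hasDerivAt (Ici_mem_nhds ht)).sub_const (3 / 8)).congr_deriv ?_
    ring
  have h := tendsto_zero_of_hasDerivAt_linear one_pos
    (ha.eventually_le_const (by norm_num)) hg hz
  rw [← zero_add (3 / 8 : ℝ)]
  exact (h.add_const (3 / 8)).congr fun t => by ring
end
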